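/- Fix a positive integer d and let g_d : 𝕋^{φ(d)} → ℂ be given by g_d(z_1,…,z_{φ(d)}) = Σ_{k=1}^{d} Π_{j=1}^{φ(d)} z_j^{c_{j,k}}, with c_{j,k} determined by x^k ≡ Σ_{j=1}^{φ(d)} c_{j,k} x^{j−1} (mod Φ_d(x)). For every nonempty open subset U of ℂ contained in the image of g_d, there exists N such that for every odd prime p ≡ 1 (mod d), every positive integer a with p^a > N, and every unit ω of multiplicative order d modulo p^a, the image of the cyclic supercharacter σ_ω modulo p^a meets U. -/

import Mathlib

open Finset Pointwise

/-- `e(θ) = exp(2πiθ)`. -/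
noncomputable def e2 (θ : ℝ) : ℂ := Complex.exp (2 * Real.pi * Complex.I * θ)

/-- The cyclic supercharacter `σ_ω : ℤ/nℤ → ℂ` attached to a unit `ω` mod `n`:
`σ_ω(y) = ∑_{j=1}^{d} e(ω^j y / n)` where `d` is the multiplicative order of `ω`. -/
noncomputable def cyclicSuperchar (n : ℕ) (ω : (ZMod n)ˣ) (y : ZMod n) : ℂ :=
  ∑ j ∈ Finset.Icc 1 (orderOf ω),
    e2 (((((ω ^ j : (ZMod n)ˣ) : ZMod n) * y).val : ℝ) / (n : ℝ))

/-- `H m`: the set of traces of matrices in `SU_m(ℂ)` (the filled `m`-cusped hypocycloid). -/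
noncomputable def H (m : ℕ) : Set ℂ :=
  Set.range fun M : Matrix.specialUnitaryGroup (Fin m) ℂ =>
    Matrix.trace (M : Matrix (Fin m) (Fin m) ℂ)

/-- `P m`: the convex hull of `H m` (the filled regular `m`-gon). -/
noncomputable def Pset (m : ℕ) : Set ℂ := convexHull ℝ (H m)

/-- `c_{j,k}` : the coefficient of `x^j` in the remainder of `x^k` mod `Φ_d(x)`. -/
noncomputable def cExp (d j k : ℕ) : ℤ :=
  (((Polynomial.X : Polynomial ℤ) ^ k) %ₘ Polynomial.cyclotomic d ℤ).coeff j

/-- The Laurent-polynomial map `g_d(z_1,…,z_{φ(d)}) = ∑_{k=1}^d ∏_j z_j^{c_{j,k}}`. -/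
noncomputable def gphi (d : ℕ) (z : Fin (Nat.totient d) → ℂ) : ℂ :=
  ∑ k ∈ Finset.Icc 1 d, ∏ j : Fin (Nat.totient d), z j ^ (cExp d (j : ℕ) k)

/-- The image of `g_d` restricted to the torus `𝕋^{φ(d)}`. -/
noncomputable def gImage (d : ℕ) : Set ℂ :=
  {w : ℂ | ∃ z : Fin (Nat.totient d) → ℂ, (∀ j, ‖z j‖ = 1) ∧ gphi d z = w}

/-- The `k`-fold Minkowski sum `A^{⊕k}` of a subset of `ℂ` with itself. -/
def minkSumPow (A : Set ℂ) (k : ℕ) : Set ℂ :=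
  {z : ℂ | ∃ f : Fin k → ℂ, (∀ i, f i ∈ A) ∧ ∑ i, f i = z}

/-- Scaling a subset of `ℂ` by a real number. -/
def scale (r : ℝ) (A : Set ℂ) : Set ℂ := (fun z => (r : ℂ) * z) '' A

/-- The sets `A k` fill out `B` as `k → ∞`. -/
def FillsOut (A : ℕ → Set ℂ) (B : Set ℂ) : Prop :=
  (∀ k, A k ⊆ B) ∧
    ∀ U : Set ℂ, IsOpen U → U.Nonempty → U ⊆ B → ∃ K : ℕ, ∀ k > K, (U ∩ A k).Nonempty

/-- A subset of `ℂ` has `k`-fold dihedral symmetry if it is stable under complex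
conjugation and under rotation by `2π/k` about the origin. -/
def HasDihedralSymm (k : ℕ) (A : Set ℂ) : Prop :=
  (∀ z ∈ A, (starRingEnd ℂ) z ∈ A) ∧ ∀ z ∈ A, e2 (1 / k) * z ∈ A

/-- The `k`-fold dihedral closure of a subset of `ℂ`. -/
def dihedralClosure (k : ℕ) (A : Set ℂ) : Set ℂ :=
  ⋂₀ {B : Set ℂ | A ⊆ B ∧ HasDihedralSymm k B}

/-- The Gauss sum `g_k(t) = ∑_{j=1}^{p} e(t j^k / p)` of order `k` mod `p`. -/
noncomputable def gaussG (p k : ℕ) (t : ZMod p) : ℂ :=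
  ∑ j ∈ Finset.Icc 1 p, e2 ((((t * (j : ZMod p) ^ k).val : ℕ) : ℝ) / (p : ℝ))

/-- The Gauss sum `G(t,χ) = ∑_{j=1}^{p-1} χ(j) e(tj/p)` attached to a character `χ` mod `p`. -/
noncomputable def GSum (p : ℕ) (χ : DirichletCharacter ℂ p) (t : ZMod p) : ℂ :=
  ∑ j ∈ Finset.Icc 1 (p - 1), χ (j : ZMod p) * e2 ((((t * (j : ZMod p)).val : ℕ) : ℝ) / (p : ℝ))

section Equidistribution

open MeasureTheory Filter Topology UnitAddTorus

variable {ι : Type*} [Fintype ι]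

/-- A nontrivial monomial has mean zero with respect to the Haar measure of the torus. -/
theorem integral_mFourier_of_ne_zero {k : ι → ℤ} (hk : k ≠ 0) :
    ∫ x : UnitAddTorus ι, mFourier k x
      ∂(Measure.pi fun _ : ι => (AddCircle.haarAddCircle : Measure UnitAddCircle)) = 0 := by
  obtain ⟨i, hi⟩ := Function.ne_iff.mp hk
  have h := integral_fintype_prod_eq_prod (𝕜 := ℂ)
    (μ := fun _ : ι => (AddCircle.haarAddCircle : Measure UnitAddCircle))
    (fun i (x : UnitAddCircle) => (fourier (k i) x : ℂ))
  refine h.trans (Finset.prod_eq_zero (Finset.mem_univ i) ?_)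
  exact integral_eq_zero_of_add_right_eq_neg (fourier_add_half_inv_index hi one_pos)

/-- **Weyl's criterion** on the torus, for finite families of points indexed along a filter. -/
theorem tendsto_average_of_mFourier {α : Type*} {l : Filter α} {β : α → Type*}
    [∀ i, Fintype (β i)] [∀ i, Nonempty (β i)] (x : ∀ i, β i → UnitAddTorus ι)
    (h : ∀ k : ι → ℤ, k ≠ 0 →
      Tendsto (fun i => (Fintype.card (β i) : ℂ)⁻¹ * ∑ b, mFourier k (x i b)) l (𝓝 0))
    (f : C(UnitAddTorus ι, ℂ)) :
    Tendsto (fun i => (Fintype.card (β i) : ℂ)⁻¹ * ∑ b, f (x i b)) l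
      (𝓝 (∫ y, f y
        ∂(Measure.pi fun _ : ι => (AddCircle.haarAddCircle : Measure UnitAddCircle)))) := by
  set μ := Measure.pi fun _ : ι => (AddCircle.haarAddCircle : Measure UnitAddCircle)
  have hint (g : C(UnitAddTorus ι, ℂ)) : Integrable g μ :=
    g.continuous.integrable_of_hasCompactSupport (HasCompactSupport.of_compactSpace _)
  have hcard (i : α) : (Fintype.card (β i) : ℂ) ≠ 0 := by simp
  have hspan : ∀ g ∈ Submodule.span ℂ (Set.range (mFourier (d := ι))),
      Tendsto (fun i => (Fintype.card (β i) : ℂ)⁻¹ * ∑ b, g (x i b)) l (𝓝 (∫ y, g y ∂μ)) := by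
    intro g hg
    induction hg using Submodule.span_induction with
    | mem g hg =>
      obtain ⟨k, rfl⟩ := hg
      rcases eq_or_ne k 0 with rfl | hk
      · simpa [mFourier_zero, hcard] using tendsto_const_nhds
      · rw [integral_mFourier_of_ne_zero hk]
        exact h k hk
    | zero => simpa using tendsto_const_nhds
    | add g₁ g₂ _ _ h₁ h₂ =>
      simpa [integral_add (hint g₁) (hint g₂), Finset.sum_add_distrib, mul_add] using h₁.add h₂
    | smul c g _ hg =>
      simpa [integral_const_mul, ← Finset.mul_sum, mul_left_comm] using hg.const_mul c
  rw [Metric.tendsto_nhds]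
  intro ε hε
  have hf : f ∈ closure (Submodule.span ℂ (Set.range (mFourier (d := ι))) :
      Set C(UnitAddTorus ι, ℂ)) := by
    rw [← Submodule.topologicalClosure_coe, span_mFourier_closure_eq_top]
    trivial
  obtain ⟨g, hg, hfg⟩ := Metric.mem_closure_iff.mp hf (ε / 3) (by positivity)
  have hnorm (y : UnitAddTorus ι) : ‖f y - g y‖ ≤ ε / 3 := by
    rw [← dist_eq_norm]
    exact (ContinuousMap.dist_apply_le_dist y).trans hfg.le
  filter_upwards [Metric.tendsto_nhds.mp (hspan g hg) (ε / 3) (by positivity)] with i hi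
  have havg : dist ((Fintype.card (β i) : ℂ)⁻¹ * ∑ b, f (x i b))
      ((Fintype.card (β i) : ℂ)⁻¹ * ∑ b, g (x i b)) ≤ ε / 3 := by
    rw [dist_eq_norm, ← mul_sub, ← Finset.sum_sub_distrib, norm_mul, norm_inv,
      Complex.norm_natCast, inv_mul_le_iff₀ (by positivity)]
    refine (norm_sum_le_of_le _ fun b _ => hnorm (x i b)).trans_eq ?_
    simp
  have hμ : dist (∫ y, g y ∂μ) (∫ y, f y ∂μ) ≤ ε / 3 := by
    rw [dist_comm, dist_eq_norm, ← integral_sub (hint f) (hint g)]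
    simpa using norm_integral_le_of_norm_le_const (μ := μ) (Eventually.of_forall hnorm)
  exact (dist_triangle4 _ _ _ _).trans_lt
    ((add_lt_add_of_lt_of_le (add_lt_add_of_le_of_lt havg hi) hμ).trans_eq (add_thirds ε))

/-- Equidistributed finite families of points on the torus eventually meet every nonempty
open set. -/
theorem eventually_exists_mem_of_mFourier {α : Type*} {l : Filter α} {β : α → Type*}
    [∀ i, Fintype (β i)] [∀ i, Nonempty (β i)] (x : ∀ i, β i → UnitAddTorus ι)
    (h : ∀ k : ι → ℤ, k ≠ 0 →
      Tendsto (fun i => (Fintype.card (β i) : ℂ)⁻¹ * ∑ b, mFourier k (x i b)) l (𝓝 0))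
    {V : Set (UnitAddTorus ι)} (hV : IsOpen V) (hne : V.Nonempty) :
    ∀ᶠ i in l, ∃ b, x i b ∈ V := by
  obtain ⟨v, hv⟩ := hne
  obtain ⟨f, hfV, hfv, hf⟩ := exists_continuous_zero_one_of_isClosed hV.isClosed_compl
    isClosed_singleton (Set.disjoint_singleton_right.mpr (Set.notMem_compl_iff.mpr hv))
  have hpos : 0 < ∫ y, f y
      ∂(Measure.pi fun _ : ι => (AddCircle.haarAddCircle : Measure UnitAddCircle)) :=
    f.continuous.integral_pos_of_hasCompactSupport_nonneg_nonzero
      (HasCompactSupport.of_compactSpace _) (fun y => (hf y).1) (x := v)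
      (by simp [hfv (Set.mem_singleton v)])
  have hlim := tendsto_average_of_mFourier x h ⟨fun y => (f y : ℂ), by fun_prop⟩
  simp only [ContinuousMap.coe_mk, integral_complex_ofReal] at hlim
  filter_upwards [hlim.eventually_ne (Complex.ofReal_ne_zero.mpr hpos.ne')] with i hi
  by_contra! hb
  exact hi (by simp [fun b => hfV (Set.mem_compl (hb b))])

end Equidistribution

section Cyclotomic

open Polynomial

/-- An element of order `d` modulo `p ^ a` with `p ∤ d` is a root of `Φ_d`. -/
theorem eval_cyclotomic_eq_zero_of_orderOf {p a d : ℕ} (hp : p.Prime) (ha : 0 < a) (hd : 0 < d)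
    (hpd : p.Coprime d) (ω : (ZMod (p ^ a))ˣ) (hω : orderOf ω = d) :
    (cyclotomic d (ZMod (p ^ a))).eval (ω : ZMod (p ^ a)) = 0 := by
  have hprod : ∏ e ∈ d.divisors, (cyclotomic e (ZMod (p ^ a))).eval (ω : ZMod (p ^ a)) = 0 := by
    rw [← eval_prod, prod_cyclotomic_eq_X_pow_sub_one hd]
    simp [← Units.val_pow_eq_pow_val, ← hω, pow_orderOf_eq_one]
  rw [← Nat.cons_self_properDivisors hd.ne', Finset.prod_cons] at hprod
  refine (IsUnit.mul_left_eq_zero ?_).mp hprod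
  refine (IsUnit.prod_iff).mpr fun e he => ?_
  rw [Nat.mem_properDivisors] at he
  have hdvd : (cyclotomic e (ZMod (p ^ a))).eval (ω : ZMod (p ^ a)) ∣
      (ω : ZMod (p ^ a)) ^ e - 1 := by
    simpa using eval_dvd (x := (ω : ZMod (p ^ a))) (cyclotomic.dvd_X_pow_sub_one e (ZMod (p ^ a)))
  refine isUnit_of_dvd_unit hdvd ?_
  have : NeZero (p ^ a) := ⟨(pow_pos hp.pos a).ne'⟩
  obtain ⟨m, hm⟩ := ZMod.natCast_zmod_surjective ((ω : ZMod (p ^ a)) ^ e - 1)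
  by_contra hu
  rw [← hm, ZMod.isUnit_natCast_iff_not_dvd_pow hp ha, not_not] at hu
  have hpdvd : (p : ZMod (p ^ a)) ∣ (ω : ZMod (p ^ a)) ^ e - 1 := by
    rw [← hm]
    exact_mod_cast Nat.cast_dvd_cast hu
  have hpow := dvd_sub_pow_of_dvd_sub hpdvd (a - 1)
  rw [Nat.sub_add_cancel ha, ← Nat.cast_pow, ZMod.natCast_self, zero_dvd_iff, one_pow,
    sub_eq_zero, ← pow_mul, ← Units.val_pow_eq_pow_val, Units.val_eq_one,
    ← orderOf_dvd_iff_pow_eq_one, hω] at hpow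
  have := (Nat.Coprime.pow_right (a - 1) hpd.symm).dvd_of_dvd_mul_right hpow
  exact absurd (Nat.le_of_dvd (Nat.pos_of_dvd_of_pos he.1 hd) this) (not_le.mpr he.2)

/-- Only finitely many moduli `n` admit a common root of `Φ_d` and a fixed nonzero integer
polynomial of smaller degree. -/
theorem exists_bound_of_common_root_cyclotomic {d : ℕ} (hd : 0 < d) {f : ℤ[X]} (hf : f ≠ 0)
    (hdeg : f.degree < d.totient) :
    ∃ N : ℕ, ∀ n : ℕ, N < n → ∀ w : ZMod n,
      (cyclotomic d (ZMod n)).eval w = 0 → aeval w f ≠ 0 := by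
  have hcop : IsCoprime (f.map (Int.castRingHom ℚ)) ((cyclotomic d ℤ).map (Int.castRingHom ℚ)) := by
    rw [map_cyclotomic]
    refine ((cyclotomic.irreducible_rat hd).coprime_iff_not_dvd.mpr fun h => ?_).symm
    have hle := degree_le_of_dvd h ((Polynomial.map_ne_zero_iff Int.cast_injective).mpr hf)
    rw [degree_cyclotomic] at hle
    exact absurd (hle.trans degree_map_le) (not_le.mpr hdeg)
  have hres : resultant f (cyclotomic d ℤ) ≠ 0 := by
    intro h0
    have hmap := resultant_map_map f (cyclotomic d ℤ) f.natDegree (cyclotomic d ℤ).natDegree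
      (Int.castRingHom ℚ)
    rw [h0, map_zero] at hmap
    rw [← natDegree_map_eq_of_injective (f := Int.castRingHom ℚ) Int.cast_injective f,
      ← natDegree_map_eq_of_injective (f := Int.castRingHom ℚ) Int.cast_injective
        (cyclotomic d ℤ)] at hmap
    exact (resultant_eq_zero_iff.mp hmap).2 hcop
  obtain ⟨u, v, -, -, huv⟩ := exists_mul_add_mul_eq_C_resultant f (cyclotomic d ℤ) le_rfl le_rfl
    (Or.inr (by rw [natDegree_cyclotomic]; exact (Nat.totient_pos.mpr hd).ne'))
  refine ⟨(resultant f (cyclotomic d ℤ)).natAbs, fun n hn w hw hfw => ?_⟩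
  have hΦ : aeval w (cyclotomic d ℤ) = 0 := by
    rw [← eval_map_algebraMap, map_cyclotomic, hw]
  have h := congrArg (aeval w) huv
  rw [map_add, map_mul, map_mul, hfw, hΦ, zero_mul, zero_mul, add_zero, aeval_C, eq_comm,
    eq_intCast, ZMod.intCast_zmod_eq_zero_iff_dvd] at h
  exact absurd (Nat.le_of_dvd (Int.natAbs_pos.mpr hres) (Int.natCast_dvd.mp h)) (not_le.mpr hn)

/-- The exponents `cExp d j k` express `w ^ k` in terms of `1, w, …, w ^ (φ(d) - 1)` for every
root `w` of `Φ_d`. -/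
theorem sum_cExp_mul_pow {R : Type*} [CommRing R] {d : ℕ} (hd : 0 < d) {w : R}
    (hw : (cyclotomic d R).eval w = 0) (k : ℕ) :
    ∑ j : Fin d.totient, (cExp d j k : R) * w ^ (j : ℕ) = w ^ k := by
  have hΦ : aeval w (cyclotomic d ℤ) = 0 := by
    rw [← eval_map_algebraMap, map_cyclotomic, hw]
  have hdeg : ((X : ℤ[X]) ^ k %ₘ cyclotomic d ℤ).degree < d.totient := by
    rw [← degree_cyclotomic d ℤ]
    exact degree_modByMonic_lt _ (cyclotomic.monic d ℤ)
  have h := aeval_modByMonic_eq_self_of_root (p := (X : ℤ[X]) ^ k) hΦ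
  rw [map_pow, aeval_X, aeval_eq_sum_range' (n := d.totient), Finset.sum_range] at h
  · simpa [cExp, zsmul_eq_mul] using h
  · rcases eq_or_ne ((X : ℤ[X]) ^ k %ₘ cyclotomic d ℤ) 0 with h0 | h0
    · simpa [h0] using hd
    · exact (natDegree_lt_iff_degree_lt h0).mpr hdeg

end Cyclotomic

section CyclicSupercharacter

open Polynomial UnitAddTorus Filter Topology

/-- The point `(y, w y, …, w ^ (m - 1) y) / n` of the `m`-dimensional torus. -/
noncomputable def orbitPoint {n : ℕ} [NeZero n] (m : ℕ) (w y : ZMod n) : UnitAddTorus (Fin m) :=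
  fun j => ZMod.toAddCircle (w ^ (j : ℕ) * y)

theorem mFourier_orbitPoint {n m : ℕ} [NeZero n] (w y : ZMod n) (k : Fin m → ℤ) :
    mFourier k (orbitPoint m w y) =
      ZMod.stdAddChar (y * ∑ j : Fin m, (k j : ZMod n) * w ^ (j : ℕ)) := by
  have h : y * ∑ j : Fin m, (k j : ZMod n) * w ^ (j : ℕ) =
      ∑ j : Fin m, k j • (w ^ (j : ℕ) * y) := by
    rw [Finset.mul_sum]
    exact Finset.sum_congr rfl fun j _ => by rw [zsmul_eq_mul]; ring
  have hψ := map_prod (ZMod.stdAddChar (N := n)).toMonoidHom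
    (fun j : Fin m => Multiplicative.ofAdd (k j • (w ^ (j : ℕ) * y))) Finset.univ
  rw [← ofAdd_sum] at hψ
  rw [h, mFourier, ContinuousMap.coe_mk]
  refine Eq.trans (Finset.prod_congr rfl fun j _ => ?_) hψ.symm
  rw [fourier_apply, orbitPoint, ← map_zsmul]
  rfl

theorem e2_val_div {n : ℕ} [NeZero n] (z : ZMod n) :
    e2 ((z.val : ℝ) / n) = ZMod.stdAddChar z := by
  conv_rhs => rw [← ZMod.natCast_zmod_val z]
  rw [← Int.cast_natCast (R := ZMod n), ZMod.stdAddChar_coe, e2]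
  push_cast
  ring_nf

/-- `g_d` read in additive coordinates is a sum of monomials. -/
theorem gphi_toCircle (d : ℕ) (x : UnitAddTorus (Fin d.totient)) :
    gphi d (fun j => (AddCircle.toCircle (x j) : ℂ)) =
      ∑ k ∈ Finset.Icc 1 d, mFourier (fun j : Fin d.totient => cExp d j k) x := by
  simp [gphi, mFourier, AddCircle.toCircle_zsmul]

theorem gphi_orbitPoint {n d : ℕ} [NeZero n] {ω : (ZMod n)ˣ} (hω : orderOf ω = d)
    (hroot : (cyclotomic d (ZMod n)).eval (ω : ZMod n) = 0) (y : ZMod n) :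
    gphi d (fun j => (AddCircle.toCircle (orbitPoint d.totient (ω : ZMod n) y j) : ℂ)) =
      cyclicSuperchar n ω y := by
  rw [gphi_toCircle, cyclicSuperchar, hω]
  refine Finset.sum_congr rfl fun k _ => ?_
  rw [mFourier_orbitPoint, sum_cExp_mul_pow (hω ▸ orderOf_pos ω) hroot, e2_val_div,
    Units.val_pow_eq_pow_val, mul_comm]

/-- The points `(y, w y, …, w ^ (φ(d) - 1) y) / n`, for a root `w` of `Φ_d` modulo `n`, become
dense in the torus as `n → ∞`. -/
theorem exists_bound_orbitPoint_mem {d : ℕ} (hd : 0 < d) {V : Set (UnitAddTorus (Fin d.totient))}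
    (hV : IsOpen V) (hne : V.Nonempty) :
    ∃ N : ℕ, ∀ (n : ℕ) [NeZero n], N < n → ∀ w : ZMod n, (cyclotomic d (ZMod n)).eval w = 0 →
      ∃ y, orbitPoint d.totient w y ∈ V := by
  let l : Filter (Σ n : ℕ+, ZMod n) := comap (fun i => (i.1 : ℕ)) atTop ⊓
    𝓟 {i | (cyclotomic d (ZMod i.1)).eval i.2 = 0}
  have hl {P : (Σ n : ℕ+, ZMod n) → Prop} : (∀ᶠ i in l, P i) ↔
      ∃ N : ℕ, ∀ n : ℕ+, N < n → ∀ w : ZMod n, (cyclotomic d (ZMod n)).eval w = 0 → P ⟨n, w⟩ := by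
    simp only [l, eventually_inf_principal, eventually_comap]
    rw [(atTop_basis_Ioi).eventually_iff]
    constructor
    · rintro ⟨N, -, h⟩
      exact ⟨N, fun n hn w hw => h hn ⟨n, w⟩ rfl hw⟩
    · rintro ⟨N, h⟩
      refine ⟨N, trivial, ?_⟩
      rintro _ hn ⟨n, w⟩ rfl hw
      exact h n hn w hw
  have hev := eventually_exists_mem_of_mFourier (l := l) (β := fun i => ZMod i.1)
    (fun i y => orbitPoint d.totient i.2 y) ?_ hV hne
  · obtain ⟨N, h⟩ := hl.mp hev
    exact ⟨N, fun n _ hn w hw => h ⟨n, Nat.pos_of_neZero n⟩ hn w hw⟩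
  intro k hk
  refine tendsto_const_nhds.congr' (EventuallyEq.symm (hl.mpr ?_))
  obtain ⟨i, hi⟩ := Function.ne_iff.mp hk
  have hcoeff : (∑ j : Fin d.totient, C (k j) * X ^ (j : ℕ) : ℤ[X]).coeff i = k i := by
    simp [coeff_X_pow, Fin.val_inj]
  obtain ⟨N, h⟩ := exists_bound_of_common_root_cyclotomic hd
    (f := ∑ j : Fin d.totient, C (k j) * X ^ (j : ℕ))
    (fun h0 => hi (by rw [← hcoeff, h0]; rfl)) (degree_sum_fin_lt k)
  refine ⟨N, fun n hn w hw => ?_⟩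
  have hb := h n hn w hw
  simp only [map_sum, map_mul, map_pow, aeval_X, eq_intCast, map_intCast] at hb
  simp only [mFourier_orbitPoint]
  rw [AddChar.sum_mulShift _ (ZMod.isPrimitive_stdAddChar n), if_neg hb]
  simp

end CyclicSupercharacter

/-- For every nonempty open subset `U` of the image of `g_d` on the torus,
there exists `N` such that for every odd prime `p ≡ 1 (mod d)`, every positive integer `a`
with `p^a > N`, and every unit `ω` of order `d` mod `p^a`, the image of `σ_ω` meets `U`. -/
theorem stmt1 (d : ℕ) (hd : 0 < d) (U : Set ℂ) (hU : IsOpen U) (hUne : U.Nonempty)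
    (hUsub : U ⊆ gImage d) :
    ∃ N : ℕ, ∀ p : ℕ, p.Prime → Odd p → p ≡ 1 [MOD d] →
      ∀ a : ℕ, 0 < a → N < p ^ a → ∀ ω : (ZMod (p ^ a))ˣ, orderOf ω = d →
        (Set.range (cyclicSuperchar (p ^ a) ω) ∩ U).Nonempty := by
  obtain ⟨u, hu⟩ := hUne
  obtain ⟨z, hz, hzu⟩ := hUsub hu
  have hG : Continuous fun x : UnitAddTorus (Fin d.totient) =>
      gphi d fun j => (AddCircle.toCircle (x j) : ℂ) := by
    simp only [gphi_toCircle]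
    fun_prop
  have hsurj (j : Fin d.totient) : ∃ t : UnitAddCircle, (AddCircle.toCircle t : ℂ) = z j := by
    obtain ⟨t, ht⟩ := (AddCircle.homeomorphCircle (T := 1) one_ne_zero).surjective
      ⟨z j, mem_sphere_zero_iff_norm.mpr (hz j)⟩
    exact ⟨t, by rw [← AddCircle.homeomorphCircle_apply one_ne_zero, ht]⟩
  choose t ht using hsurj
  obtain ⟨N, hN⟩ := exists_bound_orbitPoint_mem hd (hU.preimage hG)
    ⟨t, by simpa only [Set.mem_preimage, ht, hzu] using hu⟩
  refine ⟨N, fun p hp _ hpd a ha hlt ω hω => ?_⟩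
  have : NeZero (p ^ a) := ⟨(pow_pos hp.pos a).ne'⟩
  have hcop : p.Coprime d := (hpd.gcd_eq).trans (Nat.gcd_one_left d)
  have hroot := eval_cyclotomic_eq_zero_of_orderOf hp ha hd hcop ω hω
  obtain ⟨y, hy⟩ := hN (p ^ a) hlt ω hroot
  rw [Set.mem_preimage, gphi_orbitPoint hω hroot] at hy
  exact ⟨_, ⟨y, rfl⟩, hy⟩
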